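/- arXiv:1605.06053 — 2 statements merged into one kernel-verified Lean document; each statement's English description precedes it below -/
import Mathlib

section
/- For positive integers s₁, s₂ and 0 ≤ l ≤ s₂, 0 ≤ k ≤ s₁, the middle trivial projection applied to θ_l^{(s₂)} ⊗ θ_k^{(s₁)} ∈ M₂^{⊗s₂} ⊗ M₂^{⊗s₁} = M₂^{⊗(s₁+s₂)} in positions (s₂, s₂+1) (equivalently π̂_{s₁}^(1) with the paper's right-to-left position convention) equals ((q - q^{-1})/[2]_q) · ( q^{l - s₂ - 1 - k} [l]_q · θ_{l-1}^{(s₂-1)} ⊗ θ_k^{(s₁-1)} − [k]_q · θ_l^{(s₂-1)} ⊗ θ_{k-1}^{(s₁-1)} ), with the convention θ_{-1} = 0. -/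
noncomputable section
open Finset

/-- `q` is a nonzero complex number that is not a root of unity. -/
def NotRootOfUnity (q : ℂ) : Prop := q ≠ 0 ∧ ∀ m : ℤ, m ≠ 0 → q ^ m ≠ 1

/-- The q-integer `[m]_q = (q^m - q^(-m))/(q - q⁻¹)`. -/
def qint (q : ℂ) (m : ℤ) : ℂ := (q ^ m - q ^ (-m)) / (q - q⁻¹)

/-- The q-factorial `[n]_q! = ∏_{m=1}^n [m]_q`. -/
def qfact (q : ℂ) (n : ℕ) : ℂ := ∏ m ∈ Finset.range n, qint q ((m : ℤ) + 1)

/-- Coefficient model of the tensor power `M₂^{⊗s}` of the two-dimensional irreducible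
`U_q(sl₂)`-module: a vector is the coefficient function of the basis
`e_{l₁} ⊗ ⋯ ⊗ e_{l_s}` (index `0` is the leftmost tensorand). -/
abbrev V (s : ℕ) := (Fin s → Fin 2) → ℂ

/-- The highest weight vector `e₀ ⊗ ⋯ ⊗ e₀` of `M₂^{⊗s}`. -/
def e0 (s : ℕ) : V s := fun m => if ∀ i, m i = 0 then 1 else 0

/-- Action of `F` on `M₂^{⊗s}` via `Δ^(s)(F) = ∑ᵢ (K⁻¹)^{⊗(i-1)} ⊗ F ⊗ 1^{⊗(s-i)}`
(the first coproduct leg acts on the leftmost tensorand;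
`F.e₀ = e₁`, `F.e₁ = 0`, `K⁻¹.e_l = q^{2l-1} e_l` in `M₂`). -/
def Fop (q : ℂ) (s : ℕ) (v : V s) : V s :=
  fun m => ∑ i : Fin s,
    (∏ j : Fin s, if j < i then q ^ (2 * ((m j : ℕ) : ℤ) - 1) else 1) *
      (if m i = 1 then v (Function.update m i 0) else 0)

/-- Action of `E` on `M₂^{⊗s}` via `Δ^(s)(E) = ∑ᵢ 1^{⊗(i-1)} ⊗ E ⊗ K^{⊗(s-i)}`
(`E.e₁ = e₀`, `E.e₀ = 0`, `K.e_l = q^{1-2l} e_l` in `M₂`). -/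
def Eop (q : ℂ) (s : ℕ) (v : V s) : V s :=
  fun m => ∑ i : Fin s,
    (∏ j : Fin s, if i < j then q ^ (1 - 2 * ((m j : ℕ) : ℤ)) else 1) *
      (if m i = 0 then v (Function.update m i 1) else 0)

/-- Action of `K` on `M₂^{⊗s}` (diagonal: `K.e_l = q^{1-2l} e_l` in each tensorand). -/
def Kop (q : ℂ) (s : ℕ) (v : V s) : V s :=
  fun m => (∏ j : Fin s, q ^ (1 - 2 * ((m j : ℕ) : ℤ))) * v m

/-- The vector `θ_k^(s) = F^k.(e₀ ⊗ ⋯ ⊗ e₀)` in `M₂^{⊗s}`. -/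
def theta (q : ℂ) (s k : ℕ) : V s := (Fop q s)^[k] (e0 s)

/-- Insert the values `a`, `b` at (0-indexed) positions `j`, `j+1` into the multi-index `m`. -/
def insert2 (s j : ℕ) (m : Fin (s - 2) → Fin 2) (a b : Fin 2) : Fin s → Fin 2 :=
  fun i =>
    if (i : ℕ) < j then (if h : (i : ℕ) < s - 2 then m ⟨i, h⟩ else 0)
    else if (i : ℕ) = j then a
    else if (i : ℕ) = j + 1 then b
    else (if h : (i : ℕ) - 2 < s - 2 then m ⟨(i : ℕ) - 2, h⟩ else 0)

/-- Matrix coefficients of the `U_q(sl₂)`-equivariant projection `π̂^(1) : M₂ ⊗ M₂ → ℂ`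
onto the trivial summand (normalized so that the Clebsch–Gordan singlet maps to `1`):
`π̂(e₀⊗e₀) = π̂(e₁⊗e₁) = 0`, `π̂(e₀⊗e₁) = (q⁻¹-q)/[2]_q`, `π̂(e₁⊗e₀) = (1-q⁻²)/[2]_q`
(the first argument is the left tensorand). -/
def pival (q : ℂ) (a b : Fin 2) : ℂ :=
  if a = 0 ∧ b = 1 then (q⁻¹ - q) / qint q 2
  else if a = 1 ∧ b = 0 then (1 - q ^ (-2 : ℤ)) / qint q 2
  else 0

/-- The projection `π̂_j^(1) : M₂^{⊗s} → M₂^{⊗(s-2)}` contracting the tensorands at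
(0-indexed) positions `j`, `j+1` with `π̂^(1)`. -/
def pihat (q : ℂ) (s j : ℕ) (v : V s) : V (s - 2) :=
  fun m => ∑ a : Fin 2, ∑ b : Fin 2, pival q a b * v (insert2 s j m a b)

/-- The tensor product map `M₂^{⊗s₂} ⊗ M₂^{⊗s₁} → M₂^{⊗(s₂+s₁)}` (left block first). -/
def tens {s₂ s₁ : ℕ} (v : V s₂) (w : V s₁) : V (s₂ + s₁) :=
  fun m => v (fun i => m (Fin.castAdd s₁ i)) * w (fun i => m (Fin.natAdd s₂ i))

/-- Transport of vectors along an equality of the number of tensor factors. -/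
def reindex {n n' : ℕ} (h : n = n') (v : V n) : V n' :=
  fun m => v (fun i => m (Fin.cast h i))

theorem qint_zero_aux (q : ℂ) : qint q 0 = 0 := by simp [qint]

theorem sub_inv_ne_aux (q : ℂ) (hq : NotRootOfUnity q) : q - q⁻¹ ≠ 0 := by
  intro h
  have h0 := hq.1
  apply hq.2 2 (by norm_num)
  have h1 : q = q⁻¹ := sub_eq_zero.mp h
  have h2 : q * q = 1 := by
    nth_rewrite 2 [h1]
    exact mul_inv_cancel₀ h0
  rw [zpow_ofNat, pow_two, h2]

theorem qint_succ_aux (q : ℂ) (hq : NotRootOfUnity q) (k : ℤ) :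
    qint q (k + 1) = q ^ (-k) + q * qint q k := by
  have h0 := hq.1
  have h1 := sub_inv_ne_aux q hq
  unfold qint
  rw [neg_add, zpow_add₀ h0, zpow_add₀ h0, zpow_one, zpow_neg_one]
  rw [eq_comm, ← mul_div_assoc, eq_div_iff h1, add_mul, div_mul_cancel₀ _ h1]
  ring

theorem Fop_cons_aux (q : ℂ) (s : ℕ) (v : V (s + 1)) (a : Fin 2) (m : Fin s → Fin 2) :
    Fop q (s + 1) v (Fin.cons a m) =
      (if a = 1 then v (Fin.cons 0 m) else 0) +
        q ^ (2 * ((a : ℕ) : ℤ) - 1) * Fop q s (fun m' => v (Fin.cons a m')) m := by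
  unfold Fop
  rw [Fin.sum_univ_succ, Finset.mul_sum]
  congr 1
  · simp
  · refine Finset.sum_congr rfl fun i _ => ?_
    rw [Fin.prod_univ_succ]
    simp only [Fin.cons_zero, Fin.cons_succ, Fin.succ_lt_succ_iff, Fin.succ_pos, if_true,
      Fin.cons_update, mul_assoc]

theorem Fop_snoc_aux (q : ℂ) (s : ℕ) (v : V (s + 1)) (a : Fin 2) (m : Fin s → Fin 2) :
    Fop q (s + 1) v (Fin.snoc m a : Fin (s + 1) → Fin 2) =
      Fop q s (fun m' => v (Fin.snoc m' a : Fin (s + 1) → Fin 2)) m +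
      (∏ j : Fin s, q ^ (2 * ((m j : ℕ) : ℤ) - 1)) *
        (if a = 1 then v (Fin.snoc m 0 : Fin (s + 1) → Fin 2) else 0) := by
  unfold Fop
  rw [Fin.sum_univ_castSucc]
  congr 1
  · refine Finset.sum_congr rfl fun i _ => ?_
    rw [Fin.prod_univ_castSucc]
    have : ¬ (Fin.last s < i.castSucc) := not_lt.mpr (Fin.le_last _)
    simp only [Fin.snoc_castSucc, Fin.castSucc_lt_castSucc_iff, this, if_false, mul_one,
      Fin.snoc_update]
  · rw [Fin.prod_univ_castSucc]
    simp only [Fin.snoc_castSucc, Fin.snoc_last, Fin.castSucc_lt_last, if_true, lt_irrefl,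
      if_false, mul_one, Fin.update_snoc_last]

theorem Fop_smul_aux (q : ℂ) (s : ℕ) (c : ℂ) (v : V s) (m : Fin s → Fin 2) :
    Fop q s (fun m' => c * v m') m = c * Fop q s v m := by
  unfold Fop
  rw [Finset.mul_sum]
  refine Finset.sum_congr rfl fun i _ => ?_
  split_ifs <;> ring

theorem theta_succ_aux (q : ℂ) (s k : ℕ) : theta q s (k + 1) = Fop q s (theta q s k) := by
  unfold theta
  rw [Function.iterate_succ_apply']

theorem theta_cons_zero_aux (q : ℂ) (hq : NotRootOfUnity q) (s k : ℕ) (m : Fin s → Fin 2) :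
    theta q (s + 1) k (Fin.cons 0 m) = q ^ (-(k : ℤ)) * theta q s k m := by
  induction k generalizing m with
  | zero => simp [theta, e0, Fin.forall_fin_succ]
  | succ k ih =>
    rw [theta_succ_aux, Fop_cons_aux]
    simp only [ih]
    rw [Fop_smul_aux, ← theta_succ_aux, ← mul_assoc, ← zpow_add₀ hq.1]
    simp

theorem theta_cons_one_aux (q : ℂ) (hq : NotRootOfUnity q) (s k : ℕ) (m : Fin s → Fin 2) :
    theta q (s + 1) k (Fin.cons 1 m) = qint q k * theta q s (k - 1) m := by
  induction k generalizing m with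
  | zero => simp [theta, e0, Fin.forall_fin_succ, qint_zero_aux]
  | succ k ih =>
    rw [theta_succ_aux, Fop_cons_aux]
    simp only [ih]
    rw [Fop_smul_aux, theta_cons_zero_aux q hq, Nat.cast_add, Nat.cast_one, qint_succ_aux q hq]
    rcases k with _ | k
    · simp [qint_zero_aux]
    · rw [Nat.add_sub_cancel, Nat.add_sub_cancel, ← theta_succ_aux]
      simp
      ring

theorem theta_weight_aux (q : ℂ) (hq : NotRootOfUnity q) (s k : ℕ) (m : Fin s → Fin 2) :
    (∏ j : Fin s, q ^ (2 * ((m j : ℕ) : ℤ) - 1)) * theta q s k m =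
      q ^ (2 * (k : ℤ) - s) * theta q s k m := by
  have h0 := hq.1
  induction s generalizing k with
  | zero =>
    rcases k with _ | k
    · simp
    · have : theta q 0 (k + 1) m = 0 := by
        rw [theta_succ_aux]; simp [Fop]
      simp [this]
  | succ s ih =>
    induction m using Fin.consCases with
    | _ a m =>
    rw [Fin.prod_univ_succ]
    simp only [Fin.cons_zero, Fin.cons_succ]
    have ha : a = 0 ∨ a = 1 := by omega
    rcases ha with rfl | rfl
    · rw [theta_cons_zero_aux q hq]
      have := ih k m
      have e : q ^ (2 * (k : ℤ) - ((s + 1 : ℕ) : ℤ)) = q ^ (-1 : ℤ) * q ^ (2 * (k : ℤ) - s) := by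
        rw [← zpow_add₀ h0]; congr 1; push_cast; ring
      rw [e]
      simp only [Fin.val_zero, Nat.cast_zero, mul_zero, zero_sub]
      linear_combination q ^ (-1 : ℤ) * q ^ (-(k : ℤ)) * this
    · rw [theta_cons_one_aux q hq]
      rcases k with _ | k
      · simp [qint_zero_aux]
      · rw [Nat.add_sub_cancel]
        have := ih k m
        have e : q ^ (2 * ((k + 1 : ℕ) : ℤ) - ((s + 1 : ℕ) : ℤ)) =
            q * q ^ (2 * (k : ℤ) - s) := by
          rw [← zpow_one_add₀ h0]; congr 1; push_cast; ring
        have e2 : q ^ (2 * (((1 : Fin 2) : ℕ) : ℤ) - 1) = q := by norm_num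
        rw [e, e2]
        linear_combination q * qint q ((k + 1 : ℕ) : ℤ) * this

theorem theta_snoc_zero_aux (q : ℂ) (s k : ℕ) (m : Fin s → Fin 2) :
    theta q (s + 1) k (Fin.snoc m 0 : Fin (s + 1) → Fin 2) = theta q s k m := by
  induction k generalizing m with
  | zero => simp [theta, e0, Fin.forall_fin_succ']
  | succ k ih =>
    rw [theta_succ_aux, Fop_snoc_aux]
    simp only [ih]
    simp [theta_succ_aux]

theorem qint_succ_aux2 (q : ℂ) (hq : NotRootOfUnity q) (k s : ℤ) :
    q ^ (k + 1 - 1 - s) * qint q (k + 1) =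
      q ^ (k - 1 - s) * qint q k + q ^ (2 * k - s) := by
  have h0 := hq.1
  rw [qint_succ_aux q hq]
  unfold qint
  have h1 := sub_inv_ne_aux q hq
  have e1 : q ^ (k + 1 - 1 - s) = q ^ k * q ^ (-s) := by
    rw [← zpow_add₀ h0]; congr 1; ring
  have e2 : q ^ (k - 1 - s) = q ^ k * q⁻¹ * q ^ (-s) := by
    rw [← zpow_neg_one, ← zpow_add₀ h0, ← zpow_add₀ h0]; congr 1
  have e3 : q ^ (2 * k - s) = q ^ k * q ^ k * q ^ (-s) := by
    rw [← zpow_add₀ h0, ← zpow_add₀ h0]; congr 1; ring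
  rw [e1, e2, e3]
  have h3 : (q ^ k - q ^ (-k)) / (q - q⁻¹) * (q - q⁻¹) = q ^ k - q ^ (-k) :=
    div_mul_cancel₀ _ h1
  linear_combination q ^ k * q ^ (-s) * h3

theorem theta_snoc_one_aux (q : ℂ) (hq : NotRootOfUnity q) (s k : ℕ) (m : Fin s → Fin 2) :
    theta q (s + 1) k (Fin.snoc m 1 : Fin (s + 1) → Fin 2) =
      q ^ ((k : ℤ) - 1 - s) * qint q k * theta q s (k - 1) m := by
  induction k generalizing m with
  | zero => simp [theta, e0, Fin.forall_fin_succ', qint_zero_aux]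
  | succ k ih =>
    rw [theta_succ_aux, Fop_snoc_aux]
    simp only [ih, if_true]
    rw [Fop_smul_aux, theta_snoc_zero_aux, theta_weight_aux q hq, Nat.cast_add, Nat.cast_one,
      qint_succ_aux2 q hq, Nat.add_sub_cancel]
    rcases k with _ | k
    · simp [qint_zero_aux]
    · rw [Nat.add_sub_cancel, ← theta_succ_aux]
      ring

theorem insert2_left_aux (s t : ℕ) (m : Fin (s + 1 + (t + 1) - 2) → Fin 2) (a b : Fin 2) :
    (fun i => insert2 (s + 1 + (t + 1)) (s + 1 - 1) m a b (Fin.castAdd (t + 1) i)) =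
      (Fin.snoc (fun i : Fin s => m (Fin.cast (by omega) (Fin.castAdd t i))) a :
        Fin (s + 1) → Fin 2) := by
  funext i
  induction i using Fin.lastCases with
  | last => simp [insert2]
  | cast i =>
    have h := i.isLt
    have h2 : (i : ℕ) < s + 1 + (t + 1) - 2 := by omega
    simp only [Fin.snoc_castSucc]
    simp [insert2, h2]
    rfl

theorem insert2_right_aux (s t : ℕ) (m : Fin (s + 1 + (t + 1) - 2) → Fin 2) (a b : Fin 2) :
    (fun i => insert2 (s + 1 + (t + 1)) (s + 1 - 1) m a b (Fin.natAdd (s + 1) i)) =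
      (Fin.cons b (fun i : Fin t => m (Fin.cast (by omega) (Fin.natAdd s i))) :
        Fin (t + 1) → Fin 2) := by
  funext i
  induction i using Fin.cases with
  | zero => simp [insert2]
  | succ i =>
    have h := i.isLt
    simp only [Fin.cons_succ]
    have h1 : ¬ (s + 1 + ((i : ℕ) + 1) < s) := by omega
    have h2 : ¬ (s + 1 + ((i : ℕ) + 1) = s) := by omega
    have h3 : ¬ (s + 1 + ((i : ℕ) + 1) = s + 1) := by omega
    have h4 : s + 1 + ((i : ℕ) + 1) - 2 < s + 1 + (t + 1) - 2 := by omega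
    simp only [insert2, Nat.add_sub_cancel, Fin.val_natAdd, Fin.val_succ, h1, h2, h3, h4, if_false,
      dif_pos]
    congr 1
    ext
    simp
    omega

/-- The single middle projection formula: contracting the two middle tensorands of
`θ_l^{(s₂)} ⊗ θ_k^{(s₁)} ∈ M₂^{⊗s₂} ⊗ M₂^{⊗s₁}` (the last tensorand of the left block
and the first of the right block) with `π̂^(1)` yields
`((q-q⁻¹)/[2]_q)(q^{l-s₂-1-k} [l]_q θ_{l-1}^{(s₂-1)} ⊗ θ_k^{(s₁-1)}
  − [k]_q θ_l^{(s₂-1)} ⊗ θ_{k-1}^{(s₁-1)})`,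
with the convention `θ_{-1} = 0` (here realized by truncated subtraction: when `l = 0`
resp. `k = 0` the corresponding coefficient `[l]_q` resp. `[k]_q` vanishes). -/
theorem middle_projection_of_theta_tensor
    (q : ℂ) (hq : NotRootOfUnity q) (s₁ s₂ : ℕ) (hs₁ : 1 ≤ s₁) (hs₂ : 1 ≤ s₂)
    (l k : ℕ) (hl : l ≤ s₂) (hk : k ≤ s₁) :
    pihat q (s₂ + s₁) (s₂ - 1) (tens (theta q s₂ l) (theta q s₁ k))
      = fun m => ((q - q⁻¹) / qint q 2) *
          (q ^ ((l : ℤ) - (s₂ : ℤ) - 1 - (k : ℤ)) * qint q (l : ℤ) *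
              tens (theta q (s₂ - 1) (l - 1)) (theta q (s₁ - 1) k)
                (fun i => m (Fin.cast (by omega) i))
            - qint q (k : ℤ) *
              tens (theta q (s₂ - 1) l) (theta q (s₁ - 1) (k - 1))
                (fun i => m (Fin.cast (by omega) i))) := by
  obtain ⟨s, rfl⟩ : ∃ s, s₂ = s + 1 := ⟨s₂ - 1, by omega⟩
  obtain ⟨t, rfl⟩ : ∃ t, s₁ = t + 1 := ⟨s₁ - 1, by omega⟩
  have h0 := hq.1
  funext m
  simp only [pihat, Fin.sum_univ_two, tens, insert2_left_aux, insert2_right_aux,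
    theta_snoc_zero_aux, theta_snoc_one_aux q hq, theta_cons_zero_aux q hq,
    theta_cons_one_aux q hq]
  have e : q ^ ((l : ℤ) - ((s + 1 : ℕ) : ℤ) - 1 - (k : ℤ)) =
      q⁻¹ * q ^ ((l : ℤ) - 1 - s) * q ^ (-(k : ℤ)) := by
    rw [← zpow_neg_one, ← zpow_add₀ h0, ← zpow_add₀ h0]; congr 1; push_cast; ring
  have e2 : (1 : ℂ) - q ^ (-2 : ℤ) = (q - q⁻¹) * q⁻¹ := by
    rw [zpow_neg, zpow_ofNat]; field_simp
  have p00 : pival q 0 0 = 0 := by simp [pival]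
  have p11 : pival q 1 1 = 0 := by simp [pival]
  have p01 : pival q 0 1 = (q⁻¹ - q) / qint q 2 := by simp [pival]
  have p10 : pival q 1 0 = ((q - q⁻¹) * q⁻¹) / qint q 2 := by rw [← e2]; simp [pival]
  rw [e, p00, p11, p01, p10]
  have key : ∀ A B C D d x y z w c : ℂ,
      0 * (A * (z * D)) + (q⁻¹ - q) / c * (A * (w * B)) +
        ((q - q⁻¹) * q⁻¹ / c * (x * y * C * (z * D)) + 0 * (x * y * C * (w * B))) =
      (q - q⁻¹) / c * (q⁻¹ * x * z * y * (C * D) - w * (A * B)) := by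
    intros; ring
  exact key (theta q s l fun i => m (Fin.cast (by omega) (Fin.castAdd t i)))
    (theta q t (k - 1) fun i => m (Fin.cast (by omega) (Fin.natAdd s i)))
    (theta q s (l - 1) fun i => m (Fin.cast (by omega) (Fin.castAdd t i)))
    (theta q t k fun i => m (Fin.cast (by omega) (Fin.natAdd s i))) 0 _ _ _ _ _
end
end

section
/- In M₂^{⊗2N}, define v_{rainbow,N} = (q^{-2}-1)^{-N} ([2]_q^N/[N+1]_q!) ∑_{l=0}^N (-1)^l q^{l(N-l-1)} θ_l^{(N)} ⊗ θ_{N-l}^{(N)}. Then v_{rainbow,N} satisfies K.v = v, E.v = 0, the middle trivial projection π̂_N^(1)(v_{rainbow,N}) = v_{rainbow,N-1}, and π̂_j^(1)(v_{rainbow,N}) = 0 for all j ≠ N, 1 ≤ j ≤ 2N-1; moreover these conditions together with v_{rainbow,0} = 1 determine the vectors v_{rainbow,N} uniquely. -/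
noncomputable section
open Finset

/-- The rainbow vector
`v_{rainbow,N} = (q⁻²-1)^{-N} ([2]_q^N/[N+1]_q!) ∑_{l=0}^N (-1)^l q^{l(N-l-1)}
θ_l^{(N)} ⊗ θ_{N-l}^{(N)} ∈ M₂^{⊗2N}`. -/
def vrainbow (q : ℂ) (N : ℕ) : V (N + N) :=
  fun m => ((q ^ (-2 : ℤ) - 1) ^ N)⁻¹ * (qint q 2 ^ N / qfact q (N + 1)) *
    ∑ l ∈ Finset.range (N + 1),
      (-1) ^ l * q ^ ((l : ℤ) * ((N : ℤ) - (l : ℤ) - 1)) *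
        tens (theta q N l) (theta q N (N - l)) m

/-- weighted number of ones -/
def wt (f : ℕ → ℕ) {s : ℕ} (m : Fin s → Fin 2) : ℕ := ∑ i : Fin s, f i * (m i : ℕ)

lemma wt_update1 (f : ℕ → ℕ) {s : ℕ} (m : Fin s → Fin 2) (i : Fin s) (h : m i = 0) :
    wt f (Function.update m i 1) = wt f m + f i := by
  unfold wt
  rw [← Finset.add_sum_erase _ _ (Finset.mem_univ i),
    ← Finset.add_sum_erase (a := i) (s := Finset.univ) (fun j : Fin s => f j * (m j : ℕ)) (Finset.mem_univ i)]
  have : ∑ x ∈ univ.erase i, f x * (Function.update m i 1 x : ℕ) = ∑ x ∈ univ.erase i, f x * (m x : ℕ) := by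
    apply Finset.sum_congr rfl
    intro x hx
    rw [Function.update_of_ne (Finset.ne_of_mem_erase hx)]
  rw [this]
  simp [h]
  ring

lemma wt_update0 (f : ℕ → ℕ) {s : ℕ} (m : Fin s → Fin 2) (i : Fin s) (h : m i = 1) :
    wt f (Function.update m i 0) + f i = wt f m := by
  have := wt_update1 f (Function.update m i 0) i (by simp)
  rw [← this]
  congr 1
  rw [Function.update_idem, ← h, Function.update_eq_self]

lemma wt_snoc (f : ℕ → ℕ) {s : ℕ} (m : Fin (s+1) → Fin 2) :
    wt f m = wt f (fun i : Fin s => m i.castSucc) + f s * (m (Fin.last s) : ℕ) := by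
  simp [wt, Fin.sum_univ_castSucc]

lemma wt_cast (f : ℕ → ℕ) {n n' : ℕ} (h : n = n') (m : Fin n' → Fin 2) :
    wt f (fun i => m (Fin.cast h i)) = wt f m := by
  subst h; rfl

lemma wt_insert2 (f : ℕ → ℕ) (s j : ℕ) (hj : j + 2 ≤ s) (m : Fin (s - 2) → Fin 2) (a b : Fin 2) :
    wt f (insert2 s j m a b) = f j * a + f (j+1) * b +
      wt (fun i => if i < j then f i else f (i+2)) m := by
  obtain ⟨t, rfl⟩ : ∃ t, s = t + 2 := ⟨s - 2, by omega⟩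
  change Fin t → Fin 2 at m
  unfold wt
  change ∑ i : Fin (t+1+1), _ = _ + ∑ i : Fin t, _
  rw [Fin.sum_univ_succAbove _ (⟨j, by omega⟩ : Fin (t+1+1)),
    Fin.sum_univ_succAbove _ (⟨j, by omega⟩ : Fin (t+1))]
  have e1 : (Fin.succAbove (⟨j, by omega⟩ : Fin (t+1+1)) (⟨j, by omega⟩ : Fin (t+1)) : ℕ) = j + 1 := by
    simp [Fin.succAbove, Fin.lt_def]
  rw [← add_assoc]
  congr 1
  · congr 1
    · simp [insert2]
    · rw [e1]; simp [insert2, e1]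
  · apply Finset.sum_congr rfl
    intro i _
    have hi := i.isLt
    have e2 : (Fin.succAbove (⟨j, by omega⟩ : Fin (t+1+1))
      (Fin.succAbove (⟨j, by omega⟩ : Fin (t+1)) i) : ℕ) = if (i : ℕ) < j then (i : ℕ) else i + 2 := by
      simp only [Fin.succAbove, Fin.lt_def]
      split_ifs <;> simp_all <;> omega
    rw [e2]
    by_cases h : (i : ℕ) < j
    · simp [h, insert2, e2, Fin.succAbove, Fin.lt_def]
    · have h1 : ¬ ((i : ℕ) + 2 < j) := by omega
      have h2 : ((i : ℕ) + 2 ≠ j) := by omega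
      have h3 : ((i : ℕ) ≠ j + 1 - 2) ∨ (i : ℕ) + 2 ≠ j + 1 := by omega
      have h4 : (i : ℕ) + 2 ≠ j + 1 := by omega
      have h6 : (i : ℕ) + 1 ≠ j := by omega
      simp [h, insert2, e2, h1, h2, h6]

lemma prod_zpow {s : ℕ} (q : ℂ) (hq : q ≠ 0) (m : Fin s → Fin 2) :
    (∏ j : Fin s, q ^ (1 - 2 * ((m j : ℕ) : ℤ))) = q ^ ((s : ℤ) - 2 * (wt (fun _ => 1) m : ℤ)) := by
  induction s with
  | zero => simp [wt]
  | succ s ih =>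
    rw [Fin.prod_univ_castSucc, ih (fun i => m i.castSucc), wt_snoc, ← zpow_add₀ hq]
    congr 1; push_cast; ring

lemma prod_zpow' {s : ℕ} (q : ℂ) (hq : q ≠ 0) (m : Fin s → Fin 2) :
    (∏ j : Fin s, q ^ (2 * ((m j : ℕ) : ℤ) - 1)) = q ^ (2 * (wt (fun _ => 1) m : ℤ) - s) := by
  induction s with
  | zero => simp [wt]
  | succ s ih =>
    rw [Fin.prod_univ_castSucc, ih (fun i => m i.castSucc), wt_snoc, ← zpow_add₀ hq]
    congr 1; push_cast; ring

lemma wt_one_le {s : ℕ} (m : Fin s → Fin 2) : wt (fun _ => 1) m ≤ s := by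
  induction s with
  | zero => simp [wt]
  | succ s ih =>
    rw [wt_snoc]; have := ih (fun i => m i.castSucc); omega

lemma sub_inv_ne {q : ℂ} (hq : NotRootOfUnity q) : q - q⁻¹ ≠ 0 := by
  intro h
  have h2 := hq.2 2 (by norm_num)
  apply h2
  have := hq.1
  field_simp at h
  rw [zpow_ofNat]; linear_combination h

lemma qint_ne {q : ℂ} (hq : NotRootOfUnity q) (n : ℤ) (hn : n ≠ 0) : qint q n ≠ 0 := by
  unfold qint
  apply div_ne_zero _ (sub_inv_ne hq)
  intro h
  apply hq.2 (2 * n) (by omega)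
  have h0 := hq.1
  have : q ^ (2*n) = q^n * q^n := by rw [← zpow_add₀ h0]; congr 1; ring
  rw [this]
  nth_rewrite 1 [sub_eq_zero.mp h]
  rw [← zpow_add₀ h0]; simp

lemma qint_add {q : ℂ} (hq : q ≠ 0) (a b : ℤ) :
    qint q (a + b) = q ^ a * qint q b + q ^ (-b) * qint q a := by
  unfold qint
  rw [mul_div_assoc', mul_div_assoc', ← add_div]
  congr 1
  rw [mul_sub, mul_sub, ← zpow_add₀ hq, ← zpow_add₀ hq, ← zpow_add₀ hq, ← zpow_add₀ hq]
  rw [show -(a+b) = -b + -a by ring, show a + -b = -b + a by ring]; ring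

lemma qint_one {q : ℂ} (hq : NotRootOfUnity q) : qint q 1 = 1 := by
  unfold qint; simp [div_self (sub_inv_ne hq)]

lemma qfact_succ (q : ℂ) (n : ℕ) : qfact q (n+1) = qfact q n * qint q (n + 1) := by
  simp [qfact, Finset.prod_range_succ]

lemma qfact_ne {q : ℂ} (hq : NotRootOfUnity q) (n : ℕ) : qfact q n ≠ 0 :=
  Finset.prod_ne_zero_iff.mpr fun i _ => qint_ne hq _ (by omega)

lemma sumF {q : ℂ} (hq : NotRootOfUnity q) {s : ℕ} (m : Fin s → Fin 2) :
    ∑ i : Fin s, (∏ j : Fin s, if j < i then q ^ (2 * ((m j : ℕ) : ℤ) - 1) else 1) *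
      (if m i = 1 then q ^ (i : ℤ) else 0) =
    q ^ ((wt (fun _ => 1) m : ℤ) - 1) * qint q (wt (fun _ => 1) m) := by
  have h0 := hq.1
  induction s with
  | zero => simp [wt, qint]
  | succ s ih =>
    rw [Fin.sum_univ_castSucc, wt_snoc]
    have := ih (fun i => m i.castSucc)
    set n := wt (fun _ => 1) (fun i : Fin s => m i.castSucc) with hn
    simp only [Fin.prod_univ_castSucc, Fin.castSucc_lt_castSucc_iff, Fin.castSucc_lt_last,
      if_true, lt_irrefl, if_false, mul_one, Fin.val_castSucc, Fin.val_last]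
    rw [prod_zpow' q h0 (fun i => m i.castSucc), ← hn]
    have hl : ∀ x : Fin s, ¬ (Fin.last s < x.castSucc) := fun x => by simp [Fin.le_last]
    simp only [hl, if_false, mul_one, this]
    rcases Fin.exists_fin_two.mp ⟨m (Fin.last s), rfl⟩ with h | h
    · simp [h]
    · rw [h]
      simp only [if_true, Fin.val_one, mul_one, Nat.cast_add, Nat.cast_one, one_mul]
      rw [qint_add h0, qint_one hq, mul_add, ← mul_assoc, ← zpow_add₀ h0,
        mul_one, ← zpow_add₀ h0, ← mul_assoc, ← zpow_add₀ h0, add_comm]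
      congr 2
      · ring
      · congr 1; ring

lemma sumE {q : ℂ} (hq : NotRootOfUnity q) {s : ℕ} (m : Fin s → Fin 2) :
    ∑ i : Fin s, (∏ j : Fin s, if i < j then q ^ (1 - 2 * ((m j : ℕ) : ℤ)) else 1) *
      (if m i = 0 then q ^ (-(i : ℤ)) else 0) =
    q ^ (-(wt (fun _ => 1) m : ℤ)) * qint q (s - wt (fun _ => 1) m) := by
  have h0 := hq.1
  induction s with
  | zero => simp [wt, qint]
  | succ s ih =>
    rw [Fin.sum_univ_castSucc, wt_snoc]
    have := ih (fun i => m i.castSucc)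
    set n := wt (fun _ => 1) (fun i : Fin s => m i.castSucc) with hn
    have hl : ∀ x : Fin s, ¬ (Fin.last s < x.castSucc) := fun x => by simp [Fin.le_last]
    simp only [Fin.prod_univ_castSucc, Fin.castSucc_lt_castSucc_iff, Fin.castSucc_lt_last,
      if_true, lt_irrefl, if_false, mul_one, Fin.val_castSucc, Fin.val_last, hl,
      Finset.prod_const_one, one_mul]
    have hc : ∀ a b c : ℂ, a * b * c = a * c * b := fun a b c => by ring
    simp only [hc _ (q ^ (1 - 2 * ((m (Fin.last s) : ℕ) : ℤ)))]
    rw [← Finset.sum_mul, this]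
    rcases Fin.exists_fin_two.mp ⟨m (Fin.last s), rfl⟩ with h | h
    · rw [h]
      simp only [if_true, Fin.val_zero, Nat.cast_zero, mul_zero, add_zero, sub_zero, Nat.cast_add,
        Nat.cast_one]
      rw [show (s:ℤ) + 1 - n = 1 + (s - n) by ring, qint_add h0 1, qint_one hq, mul_add, mul_one,
        ← zpow_add₀ h0, show -(n:ℤ) + -(s - n) = -s by ring]
      ring
    · rw [h]
      simp only [one_ne_zero, if_false, Fin.val_one, Nat.cast_add, Nat.cast_one, mul_one, add_zero]
      rw [mul_right_comm, ← zpow_add₀ h0]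
      congr 2 <;> ring

def tri (n : ℕ) : ℤ := ∑ i ∈ Finset.range n, (i : ℤ)

lemma tri_succ (n : ℕ) : tri (n+1) = tri n + n := by simp [tri, Finset.sum_range_succ]

lemma two_tri (n : ℕ) : 2 * tri n = n * (n - 1) := by
  induction n with
  | zero => simp [tri]
  | succ n ih => rw [tri_succ]; push_cast; linarith

lemma wt_eq_zero {s : ℕ} (m : Fin s → Fin 2) : wt (fun _ => 1) m = 0 ↔ ∀ i, m i = 0 := by
  simp [wt]

lemma theta_closed {q : ℂ} (hq : NotRootOfUnity q) (s k : ℕ) (m : Fin s → Fin 2) :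
    theta q s k m = if wt (fun _ => 1) m = k then qfact q k * q ^ (tri k - wt (fun i => i) m) else 0 := by
  have h0 := hq.1
  induction k generalizing m with
  | zero =>
    simp only [theta, Function.iterate_zero, id, e0, wt_eq_zero]
    by_cases h : ∀ i, m i = 0
    · have : wt (fun i => i) m = 0 := by simp [wt, h]
      simp [h, qfact, tri, this]
    · simp [h]
  | succ k ih =>
    have : theta q s (k+1) = Fop q s (theta q s k) := by
      simp [theta, Function.iterate_succ_apply']
    rw [this]
    simp only [Fop, ih]
    by_cases hm : wt (fun _ => 1) m = k + 1
    · rw [if_pos hm]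
      have h2 := sumF hq m
      rw [hm] at h2
      have : ∀ i : Fin s, (if m i = 1 then
          if wt (fun _ => 1) (Function.update m i 0) = k then
            qfact q k * q ^ (tri k - wt (fun i => i) (Function.update m i 0)) else 0 else 0) =
          (if m i = 1 then q ^ (i : ℤ) else 0) * (qfact q k * q ^ (tri k - wt (fun i => i) m)) := by
        intro i
        split_ifs with h1 h2
        · have e := wt_update0 (fun i => i) m i h1
          rw [← e, mul_left_comm, ← zpow_add₀ h0]
          congr 2; push_cast; ring
        · have e := wt_update0 (fun _ => 1) m i h1
          omega
        · simp
      simp only [this, ← mul_assoc]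
      rw [← Finset.sum_mul, ← Finset.sum_mul, h2, qfact_succ, tri_succ]
      push_cast
      rw [show tri k + k - (wt (fun i => i) m : ℤ) = (k + 1 - 1) + (tri k - wt (fun i => i) m) by ring,
        zpow_add₀ h0]
      ring
    · rw [if_neg hm]
      apply Finset.sum_eq_zero
      intro i _
      split_ifs with h1 h2
      · have e := wt_update0 (fun _ => 1) m i h1
        omega
      · simp
      · simp

/-- ones in the first `N` positions -/
def lw (N : ℕ) {s : ℕ} (m : Fin s → Fin 2) : ℕ := wt (fun i => if i < N then 1 else 0) m

lemma lw_le (N : ℕ) {s : ℕ} (m : Fin s → Fin 2) : lw N m ≤ wt (fun _ => 1) m := by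
  unfold lw wt
  apply Finset.sum_le_sum
  intro i _
  dsimp only
  split_ifs <;> simp

lemma lw_left {N M : ℕ} (m : Fin (N + M) → Fin 2) :
    wt (fun _ => 1) (fun i => m (Fin.castAdd M i)) = lw N m := by
  simp [lw, wt, Fin.sum_univ_add]

lemma lw_le' {N M : ℕ} (m : Fin (N + M) → Fin 2) : lw N m ≤ N := by
  rw [← lw_left]; exact wt_one_le _

lemma lw_right {N M : ℕ} (m : Fin (N + M) → Fin 2) :
    lw N m + wt (fun _ => 1) (fun i => m (Fin.natAdd N i)) = wt (fun _ => 1) m := by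
  simp [lw, wt, Fin.sum_univ_add]

lemma wtid_split {N M : ℕ} (m : Fin (N + M) → Fin 2) :
    wt (fun i => i) m = wt (fun i => i) (fun i => m (Fin.castAdd M i)) +
      wt (fun i => i) (fun i => m (Fin.natAdd N i)) +
      N * wt (fun _ => 1) (fun i => m (Fin.natAdd N i)) := by
  simp [wt, Fin.sum_univ_add, add_mul, Finset.sum_add_distrib, Finset.mul_sum]
  ring

def Cc (q : ℂ) (N : ℕ) : ℂ := ((q ^ (-2 : ℤ) - 1) ^ N)⁻¹ * (qint q 2 ^ N / qfact q (N + 1))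

def vv (q : ℂ) (N l : ℕ) (S : ℤ) : ℂ := Cc q N * ((-1) ^ l * qfact q l * qfact q (N - l) *
  q ^ (tri N + N * N - (N + 1) * l - S))

lemma v_closed {q : ℂ} (hq : NotRootOfUnity q) (N : ℕ) (m : Fin (N + N) → Fin 2) :
    vrainbow q N m = if wt (fun _ => 1) m = N then vv q N (lw N m) (wt (fun i => i) m) else 0 := by
  have h0 := hq.1
  unfold vrainbow
  simp only [tens, theta_closed hq]
  rw [lw_left]
  have hr := lw_right m
  have hl := lw_le' m
  have hs := wtid_split m
  set l := lw N m
  set r := wt (fun _ => 1) (fun i => m (Fin.natAdd N i))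
  rw [Finset.sum_eq_single l]
  · by_cases h : wt (fun _ => 1) m = N
    · have hr' : r = N - l := by omega
      rw [if_pos rfl, if_pos hr', if_pos h]
      unfold vv
      change Cc q N * _ = _
      congr 1
      have : tri N + N * N - (N + 1) * l - (wt (fun i => i) m : ℤ) = (l:ℤ) * (N - l - 1) +
        (tri l - (wt (fun i => i) (fun i => m (Fin.castAdd N i)) : ℤ)) +
        (tri (N - l) - wt (fun i => i) (fun i => m (Fin.natAdd N i))) := by
        rw [hs, hr']
        have t1 := two_tri N
        have t2 := two_tri l
        have t3 := two_tri (N - l)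
        push_cast [Nat.cast_sub hl] at t3 ⊢
        apply mul_left_cancel₀ (two_ne_zero : (2:ℤ) ≠ 0)
        linear_combination t1 - t2 - t3
      rw [this, zpow_add₀ h0, zpow_add₀ h0]
      ring
    · have hr' : r ≠ N - l := by omega
      rw [if_neg hr', if_neg h]; simp
  · intro b _ hb
    rw [if_neg (Ne.symm hb)]; simp
  · intro h
    simp at h; omega

lemma v_K {q : ℂ} (hq : NotRootOfUnity q) (N : ℕ) : Kop q (N + N) (vrainbow q N) = vrainbow q N := by
  ext m
  unfold Kop
  rw [v_closed hq, prod_zpow q hq.1]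
  split_ifs with h
  · rw [h, show ((N + N : ℕ) : ℤ) - 2 * (N:ℤ) = 0 by push_cast; ring]; simp
  · simp

lemma v_E {q : ℂ} (hq : NotRootOfUnity q) (N : ℕ) : Eop q (N + N) (vrainbow q N) = 0 := by
  have h0 := hq.1
  ext m
  unfold Eop
  simp only [v_closed hq]
  by_cases hm : wt (fun _ => 1) m + 1 = N
  · have key : ∀ i : Fin (N + N), (if m i = 0 then
        if wt (fun _ => 1) (Function.update m i 1) = N then
          vv q N (lw N (Function.update m i 1)) (wt (fun i => i) (Function.update m i 1)) else 0 else 0)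
        = if m i = 0 then vv q N (lw N m + if (i:ℕ) < N then 1 else 0) (wt (fun i => i) m + i) else 0 := by
      intro i
      by_cases h : m i = 0
      · rw [if_pos h, if_pos h, wt_update1 _ _ _ h, if_pos hm, lw, wt_update1 _ _ _ h, wt_update1 _ _ _ h]
        push_cast; rfl
      · simp [h]
    simp only [key]
    have hr := lw_right m
    have e1 := sumE hq (fun i => m (Fin.castAdd N i))
    have e2 := sumE hq (fun i => m (Fin.natAdd N i))
    rw [lw_left] at e1
    have p2 := prod_zpow q h0 (fun i => m (Fin.natAdd N i))
    set l := lw N m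
    set r := wt (fun _ => 1) (fun i => m (Fin.natAdd N i))
    set S := wt (fun i => i) m
    have v1 : ∀ i : ℕ, vv q N (l + 1) (S + i) = q ^ (-(i:ℤ)) * vv q N (l+1) S := by
      intro i
      unfold vv
      rw [show tri N + N * N - (N + 1) * (l+1 : ℕ) - (S + i : ℤ) =
        -i + (tri N + N * N - (N + 1) * (l+1 : ℕ) - (S:ℤ)) by ring, zpow_add₀ h0]
      ring
    have v2 : ∀ i : ℕ, vv q N l (S + (N + i : ℕ)) = q ^ (-(i:ℤ)) * vv q N l (S + N) := by
      intro i
      unfold vv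
      rw [show tri N + N * N - (N + 1) * (l : ℕ) - (S + (N + i : ℕ) : ℤ) =
        -i + (tri N + N * N - (N + 1) * (l : ℕ) - (S + N:ℤ)) by push_cast; ring, zpow_add₀ h0]
      ring
    rw [Fin.sum_univ_add]
    have c1 : ∀ x y : Fin N, ((Fin.natAdd N x : Fin (N+N)) < Fin.castAdd N y) ↔ False := by
      intro x y; rw [Fin.lt_def]; simp only [Fin.val_natAdd, Fin.val_castAdd, iff_true, iff_false]; omega
    have c2 : ∀ x y : Fin N, ((Fin.castAdd N x : Fin (N+N)) < Fin.natAdd N y) ↔ True := by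
      intro x y; rw [Fin.lt_def]; simp only [Fin.val_natAdd, Fin.val_castAdd, iff_true, iff_false]; omega
    have c3 : ∀ x y : Fin N, ((Fin.castAdd N x : Fin (N+N)) < Fin.castAdd N y) ↔ x < y := by
      intro x y; rw [Fin.lt_def, Fin.lt_def]; simp [-Fin.val_fin_lt]
    have c4 : ∀ x y : Fin N, ((Fin.natAdd N x : Fin (N+N)) < Fin.natAdd N y) ↔ x < y := by
      intro x y; rw [Fin.lt_def, Fin.lt_def]; simp [-Fin.val_fin_lt]
    simp only [Fin.prod_univ_add, c1, c2, c3, c4, if_true, if_false, Finset.prod_const_one, one_mul, p2,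
      Fin.val_castAdd, Fin.val_natAdd, Fin.is_lt, not_lt.mpr (Nat.le_add_right N _), add_zero, v1, v2]
    have r1 : ∀ (P : Prop) [Decidable P] (a b : ℂ), (if P then a * b else 0) = (if P then a else 0) * b := by
      intro P _ a b; split_ifs <;> simp
    simp only [r1, ← mul_assoc]
    rw [← Finset.sum_mul, ← Finset.sum_mul, e2]
    simp only [mul_right_comm _ (q ^ ((N:ℤ) - 2 * (r : ℤ)))]
    rw [← Finset.sum_mul, e1]
    obtain ⟨N, rfl⟩ : ∃ M, N = M + 1 := ⟨N - 1, by omega⟩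
    have hr2 : r = N - l := by omega
    have hl : l ≤ N := by omega
    unfold vv
    rw [show N + 1 - l = (N - l) + 1 by omega, qfact_succ q (N - l), qfact_succ q l,
      show N + 1 - (l + 1) = N - l by omega, hr2]
    push_cast [Nat.cast_sub hl]
    rw [show (N:ℤ) + 1 - (N - l) = l + 1 by ring, show (N:ℤ) - l + 1 = N + 1 - l by ring, pow_succ]
    set A := tri (N+1)
    have x1 : q ^ (-(l:ℤ)) * q ^ ((N:ℤ) + 1 - 2 * (N - l)) * q ^ (A + (N+1) * (N+1) - (N+1+1) * (l + 1) - S)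
      = q ^ (-((N:ℤ) - l)) * q ^ (A + (N+1) * (N+1) - (N+1+1) * l - (S + (N + 1))) := by
      rw [← zpow_add₀ h0, ← zpow_add₀ h0, ← zpow_add₀ h0]
      congr 1; ring
    simp only [Pi.zero_apply]
    linear_combination (-(Cc q (N+1)) * qint q (N+1-l) * qint q (l+1) * (-1)^l * qfact q l * qfact q (N-l)) * x1
  · apply Finset.sum_eq_zero
    intro i _
    split_ifs with h1 h2
    · rw [wt_update1 _ _ _ h1] at h2
      omega
    · simp
    · simp

lemma wt_comb (M : ℕ) {s : ℕ} (m : Fin s → Fin 2) :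
    wt (fun i => if i < M then i else i + 2) m + 2 * lw M m = wt (fun i => i) m + 2 * wt (fun _ => 1) m := by
  simp only [lw, wt, Finset.mul_sum, ← Finset.sum_add_distrib]
  apply Finset.sum_congr rfl
  intro i _
  split_ifs <;> ring

lemma wt_one_insert (s j : ℕ) (hj : j + 2 ≤ s) (m : Fin (s - 2) → Fin 2) (a b : Fin 2) :
    wt (fun _ => 1) (insert2 s j m a b) = a + b + wt (fun _ => 1) m := by
  rw [wt_insert2 _ _ _ hj]; simp

lemma pihat_apply (q : ℂ) (s j : ℕ) (v : V s) (m) : pihat q s j v m =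
    (q⁻¹ - q) / qint q 2 * v (insert2 s j m 0 1) + (1 - q ^ (-2 : ℤ)) / qint q 2 * v (insert2 s j m 1 0) := by
  simp [pihat, pival, Fin.sum_univ_two]

lemma v_mid {q : ℂ} (hq : NotRootOfUnity q) (N : ℕ) (h : N + N = N + 1 + (N + 1) - 2) :
    pihat q (N + 1 + (N + 1)) N (vrainbow q (N + 1)) = reindex h (vrainbow q N) := by
  have h0 := hq.1
  ext m
  rw [pihat_apply]
  unfold reindex
  rw [v_closed hq, v_closed hq, v_closed hq, wt_one_insert _ _ (by omega), wt_one_insert _ _ (by omega)]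
  rw [wt_cast, wt_cast, show lw N (fun i => m (Fin.cast h i)) = lw N m from wt_cast _ _ _]
  by_cases hm : wt (fun _ => 1) m = N
  · have hc := wt_comb N m
    have hl := lw_le N m
    rw [hm] at hc hl
    simp only [lw, wt_insert2 _ (N+1+(N+1)) N (by omega)]
    have e : wt (fun i => if i < N then (if i < N + 1 then 1 else 0) else if i + 2 < N + 1 then 1 else 0) m =
        lw N m := by
      unfold lw; congr 1; ext i; split_ifs <;> omega
    rw [e]
    change _ = if wt (fun _ => 1) m = N then vv q N (lw N m) _ else 0
    rw [if_pos hm]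
    set l := lw N m
    set W := wt (fun i => if i < N then i else i + 2) m
    set S := wt (fun i => i) m
    have hW : W = S + 2 * (N - l) := by omega
    simp only [Fin.val_zero, Fin.val_one, hm, hW]
    rw [if_pos (by omega), if_pos (by omega)]
    try rw [if_pos (by omega : 1 + N = N + 1)]
    simp only [lt_irrefl, lt_add_iff_pos_right, if_true, if_false, mul_zero, mul_one, zero_add, add_zero, zero_lt_one]
    unfold vv Cc
    have k2 : q ^ (-2:ℤ) - 1 ≠ 0 := by
      have := hq.2 (-2) (by norm_num)
      exact sub_ne_zero.mpr this
    have k3 := qint_ne hq 2 (by norm_num)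
    have k4 := qfact_ne hq (N+1)
    have k5 := qint_ne hq ((N+1:ℕ) + 1) (by omega)
    rw [show N + 1 - l = (N - l) + 1 by omega, qfact_succ q (N - l),
      show N + 1 - (1 + l) = N - l by omega, add_comm 1 l, qfact_succ q l, qfact_succ q (N+1), tri_succ]
    have ad := qint_add h0 (l + 1) (N + 1 - l)
    rw [show (l:ℤ) + 1 + (N + 1 - l) = ((N+1:ℕ):ℤ) + 1 by push_cast; ring] at ad
    push_cast [Nat.cast_sub hl]
    rw [show (N:ℤ) - l + 1 = N + 1 - l by ring]
    push_cast at ad k5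
    have x1 : tri N + N + (N + 1) * (N + 1) - (N + 1 + 1) * l - (N + 1 + (S + 2 * (N - l))) =
      (tri N + N * N - (N+1) * l - (S:ℤ)) + l := by ring
    have x2 : tri N + N + (N + 1) * (N + 1) - (N + 1 + 1) * (l + 1) - (N + (S + 2 * (N - l))) =
      (tri N + N * N - (N+1) * l - (S:ℤ)) + (-(N + 1 - l)) := by ring
    rw [x1, x2, zpow_add₀ h0, zpow_add₀ h0]
    rw [zpow_add_one₀ h0] at ad
    have d1 : q⁻¹ - q = (q ^ (-2:ℤ) - 1) * q := by
      rw [zpow_neg, zpow_ofNat]; field_simp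
    have d2 : 1 - q ^ (-2:ℤ) = -(q ^ (-2:ℤ) - 1) := by ring
    rw [d1, d2]
    generalize q ^ (-2:ℤ) - 1 = D at *
    generalize q ^ (tri N + N * N - (N+1) * l - (S:ℤ)) = Y at *
    generalize q ^ (l:ℤ) = a at *
    generalize q ^ (-((N:ℤ) + 1 - l)) = b at *
    generalize qint q ((N:ℤ) + 1 + 1) = Q at *
    generalize qint q ((N:ℤ) + 1 - l) = Q1 at *
    generalize qint q ((l:ℤ) + 1) = Q2 at *
    generalize qint q 2 = T at *
    have : D * q / T * ((D ^ (N + 1))⁻¹ * (T ^ (N + 1) / (qfact q (N+1) * Q)) *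
        ((-1) ^ l * qfact q l * (qfact q (N-l) * Q1) * (Y * a))) +
      -D / T * ((D ^ (N + 1))⁻¹ * (T ^ (N + 1) / (qfact q (N+1) * Q)) *
        ((-1) ^ (l+1) * (qfact q l * Q2) * qfact q (N-l) * (Y * b))) =
      (D * (D ^ (N+1))⁻¹) * (T ^ (N + 1) / T) * ((a * q * Q1 + b * Q2) / Q) *
       ((-1) ^ l * qfact q l * qfact q (N-l) * Y / qfact q (N+1)) := by
      ring
    rw [this, ← ad, div_self k5, pow_succ, pow_succ, mul_inv, mul_left_comm, mul_inv_cancel₀ k2,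
      mul_div_cancel_right₀ _ k3]
    ring
  · simp only [Fin.val_zero, Fin.val_one]
    rw [if_neg (by omega), if_neg (by omega)]
    simp [hm]

lemma pihat_zero_iff {q : ℂ} (hq : NotRootOfUnity q) (s j : ℕ) (v : V s) : pihat q s j v = 0 ↔
    ∀ m, v (insert2 s j m 1 0) = q * v (insert2 s j m 0 1) := by
  have h0 := hq.1
  have k3 := qint_ne hq 2 (by norm_num)
  have k2 : 1 - q ^ (-2:ℤ) ≠ 0 := by
    have := hq.2 (-2) (by norm_num)
    exact sub_ne_zero.mpr (Ne.symm this)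
  have e : q⁻¹ - q = - (1 - q ^ (-2:ℤ)) * q := by
    rw [zpow_neg, zpow_ofNat]; field_simp; ring
  rw [funext_iff]
  apply forall_congr'
  intro m
  rw [pihat_apply, e]
  have : -(1 - q ^ (-2:ℤ)) * q / qint q 2 * v (insert2 s j m 0 1) +
    (1 - q ^ (-2:ℤ)) / qint q 2 * v (insert2 s j m 1 0) =
    (1 - q ^ (-2:ℤ)) / qint q 2 * (v (insert2 s j m 1 0) - q * v (insert2 s j m 0 1)) := by ring
  rw [this, Pi.zero_apply, mul_eq_zero, sub_eq_zero]
  have : (1 - q ^ (-2:ℤ)) / qint q 2 ≠ 0 := div_ne_zero k2 k3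
  simp only [this, false_or]

lemma v_side {q : ℂ} (hq : NotRootOfUnity q) (N j : ℕ) (hj : j + 2 ≤ N + N) (hjN : j ≠ N - 1) :
    pihat q (N + N) j (vrainbow q N) = 0 := by
  have h0 := hq.1
  rw [pihat_zero_iff hq]
  intro m
  rw [v_closed hq, v_closed hq, wt_one_insert _ _ (by omega), wt_one_insert _ _ (by omega)]
  have : lw N (insert2 (N+N) j m 1 0) = lw N (insert2 (N+N) j m 0 1) := by
    simp only [lw, wt_insert2 _ (N+N) j hj]
    congr 1
    simp; split_ifs <;> omega
  rw [this, wt_insert2 _ (N+N) j hj, wt_insert2 _ (N+N) j hj]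
  simp only [Fin.val_zero, Fin.val_one, zero_add, add_zero, mul_one, mul_zero, add_comm]
  split_ifs
  · unfold vv
    have : ∀ X : ℤ, q * q ^ X = q ^ (X + 1) := fun X => by rw [zpow_add_one₀ h0, mul_comm]
    rw [mul_left_comm q, mul_left_comm q _ (q ^ _), this]
    congr 3
    push_cast
    ring
  · simp

lemma insert2_eq {s j : ℕ} (hj : j + 2 ≤ s) (m : Fin s → Fin 2) (a b : Fin 2) :
    insert2 s j (fun i => if (i:ℕ) < j then m ⟨i, by omega⟩ else m ⟨i + 2, by omega⟩) a b =
    fun i : Fin s => if (i:ℕ) = j then a else if (i:ℕ) = j + 1 then b else m i := by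
  ext i
  unfold insert2
  have := i.isLt
  by_cases h1 : (i:ℕ) < j
  · have h2 : (i:ℕ) < s - 2 := by omega
    have h3 : (i:ℕ) ≠ j := by omega
    have h4 : (i:ℕ) ≠ j + 1 := by omega
    simp [h1, h2, h3, h4]
  · by_cases h3 : (i:ℕ) = j
    · simp [h3]
    · by_cases h4 : (i:ℕ) = j + 1
      · simp [h4]
      · have h5 : (i:ℕ) - 2 < s - 2 := by omega
        have h6 : ¬ (i:ℕ) - 2 < j := by omega
        have h7 : (i:ℕ) - 2 + 2 = i := by omega
        simp [h1, h3, h4, h5, h6, h7]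

lemma exists_perm {s : ℕ} (m m' : Fin s → Fin 2) (h : wt (fun _ => 1) m = wt (fun _ => 1) m') :
    ∃ σ : Equiv.Perm (Fin s), m = m' ∘ σ := by
  have c1 : ∀ m : Fin s → Fin 2, Fintype.card {i // m i = 1} = wt (fun _ => 1) m := by
    intro m
    rw [Fintype.card_subtype, Finset.card_filter]
    unfold wt
    apply Finset.sum_congr rfl
    intro i _
    rcases Fin.exists_fin_two.mp ⟨m i, rfl⟩ with h | h <;> simp [h]
  have c0 : ∀ m : Fin s → Fin 2, Fintype.card {i // m i = 0} = s - wt (fun _ => 1) m := by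
    intro m
    rw [← c1]
    have := Fintype.card_subtype_compl (fun i => m i = 1)
    rw [Fintype.card_fin] at this
    rw [← this]
    apply Fintype.card_congr
    apply Equiv.subtypeEquivRight
    intro x; omega
  have e : ∀ c : Fin 2, Nonempty ({i // m i = c} ≃ {i // m' i = c}) := by
    intro c
    rw [← Fintype.card_eq]
    rcases Fin.exists_fin_two.mp ⟨c, rfl⟩ with h | h <;> subst h
    · rw [c0, c0, h]
    · rw [c1, c1, h]
  refine ⟨Equiv.ofFiberEquiv (fun c => (e c).some), ?_⟩
  ext i
  simp only [Function.comp]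
  exact congrArg _ (Equiv.ofFiberEquiv_map (f := m) (g := m') (fun c => (e c).some) i).symm

lemma perm_inv {q : ℂ} (hq : NotRootOfUnity q) {s : ℕ} (u : V s)
    (hu : ∀ j, j + 2 ≤ s → pihat q s j u = 0) (σ : Equiv.Perm (Fin s)) (m : Fin s → Fin 2) :
    u (m ∘ σ) * q ^ (wt (fun i => i) (m ∘ σ)) = u m * q ^ (wt (fun i => i) m) := by
  have h0 := hq.1
  cases s with
  | zero => 
    have : m ∘ σ = m := Subsingleton.elim _ _
    rw [this]
  | succ n =>
    have hσ : σ ∈ Submonoid.closure (Set.range fun i : Fin n => Equiv.swap i.castSucc i.succ) := by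
      rw [Equiv.Perm.mclosure_swap_castSucc_succ]; trivial
    induction hσ using Submonoid.closure_induction generalizing m with
    | one => rfl
    | mul x y _ _ hx hy =>
      rw [Equiv.Perm.coe_mul, ← Function.comp_assoc, hy, hx]
    | mem x hx =>
      obtain ⟨j, rfl⟩ := hx
      have hj : (j:ℕ) + 2 ≤ n + 1 := by omega
      have H := (pihat_zero_iff hq _ _ _).mp (hu j hj)
        (fun i => if (i:ℕ) < j then m ⟨i, by omega⟩ else m ⟨i + 2, by omega⟩)
      set m' : Fin (n+1-2) → Fin 2 := 
        (fun i => if (i:ℕ) < j then m ⟨i, by omega⟩ else m ⟨i + 2, by omega⟩) with hm'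
      have A : m = insert2 (n+1) j m' (m j.castSucc) (m j.succ) := by
        rw [hm', insert2_eq hj]
        ext i
        split_ifs with h1 h2
        · congr 2; ext; simpa using h1
        · congr 2; ext; simpa using h2
        · rfl
      have B : m ∘ (Equiv.swap j.castSucc j.succ) = insert2 (n+1) j m' (m j.succ) (m j.castSucc) := by
        rw [hm', insert2_eq hj]
        ext i
        simp only [Function.comp]
        split_ifs with h1 h2
        · have : i = j.castSucc := by ext; simpa using h1
          rw [this, Equiv.swap_apply_left]
        · have : i = j.succ := by ext; simpa using h2
          rw [this, Equiv.swap_apply_right]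
        · rw [Equiv.swap_apply_of_ne_of_ne]
          · intro h; apply h1; rw [h]; simp
          · intro h; apply h2; rw [h]; simp
      rw [B]
      nth_rewrite 5 [A]
      nth_rewrite 7 [A]
      generalize m j.castSucc = a
      generalize m j.succ = b
      have w := wt_insert2 (fun i => i) (n+1) j hj m'
      fin_cases a <;> fin_cases b <;> simp [w, H] <;> ring

lemma unique {q : ℂ} (hq : NotRootOfUnity q) (N : ℕ) (hN : 1 ≤ N) (u : V (N + N))
    (hK : Kop q (N + N) u = u) (hE : Eop q (N + N) u = 0)
    (hu : ∀ j, j + 2 ≤ N + N → pihat q (N + N) j u = 0) : u = 0 := by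
  have h0 := hq.1
  ext m0
  by_cases hm0 : wt (fun _ => 1) m0 = N
  · obtain ⟨i0, hi0⟩ : ∃ i, m0 i = 1 := by
      by_contra! h
      have : wt (fun _ => 1) m0 = 0 := by
        rw [wt_eq_zero]; intro i; have := h i; omega
      omega
    have e := wt_update0 (fun _ => 1) m0 i0 hi0
    set m := Function.update m0 i0 0
    have hEm := congrFun hE m
    unfold Eop at hEm
    set c := u m0 * q ^ (wt (fun i => i) m0) with hc
    have key : ∀ i, (if m i = 0 then u (Function.update m i 1) else 0) =
        (if m i = 0 then q ^ (-(i:ℤ)) else 0) * (c * q ^ (-(wt (fun i => i) m : ℤ))) := by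
      intro i
      split_ifs with h
      · obtain ⟨σ, hσ⟩ := exists_perm (Function.update m i 1) m0 (by rw [wt_update1 _ _ _ h]; omega)
        have := perm_inv hq u hu σ m0
        rw [← hσ, ← hc, wt_update1 _ _ _ h] at this
        rw [← this, mul_left_comm, ← zpow_add₀ h0, mul_assoc, ← zpow_natCast, ← zpow_add₀ h0]
        push_cast
        rw [show (wt (fun i => i) m : ℤ) + i + (-i + - (wt (fun i => i) m : ℤ)) = 0 by ring]; simp
      · simp
    simp only [key, ← mul_assoc] at hEm
    rw [← Finset.sum_mul, ← Finset.sum_mul, sumE hq] at hEm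
    have k := qint_ne hq (((N + N : ℕ) : ℤ) - wt (fun _ => 1) m) (by omega)
    simp only [Pi.zero_apply, mul_eq_zero, zpow_ne_zero _ h0, k, false_or, or_false] at hEm
    rw [hc] at hEm
    simpa [h0] using hEm
  · have := congrFun hK m0
    unfold Kop at this
    rw [prod_zpow q h0] at this
    have k := hq.2 (((N + N : ℕ):ℤ) - 2 * wt (fun _ => 1) m0) (by omega)
    by_contra h
    exact k (mul_right_cancel₀ h (by rw [this, one_mul]))

/-- The rainbow vectors satisfy `K.v = v`, `E.v = 0`, the middle trivial projection
`π̂_N^(1)(v_{rainbow,N}) = v_{rainbow,N-1}` (positions `N`, `N+1`, i.e. 0-indexed `N-1`),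
all other adjacent trivial projections vanish, and `v_{rainbow,0} = 1`; moreover these
conditions determine the family uniquely. -/
theorem vrainbow_projections_and_uniqueness (q : ℂ) (hq : NotRootOfUnity q) :
    (vrainbow q 0 = fun _ => 1) ∧
    (∀ N : ℕ, Kop q (N + N) (vrainbow q N) = vrainbow q N ∧
      Eop q (N + N) (vrainbow q N) = 0) ∧
    (∀ N : ℕ, 1 ≤ N →
      pihat q (N + N) (N - 1) (vrainbow q N)
          = reindex (by omega) (vrainbow q (N - 1)) ∧
      ∀ j : ℕ, j + 2 ≤ N + N → j ≠ N - 1 → pihat q (N + N) j (vrainbow q N) = 0) ∧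
    (∀ w : (N : ℕ) → V (N + N),
      (w 0 = fun _ => 1) →
      (∀ N : ℕ, Kop q (N + N) (w N) = w N ∧ Eop q (N + N) (w N) = 0) →
      (∀ N : ℕ, 1 ≤ N →
        pihat q (N + N) (N - 1) (w N) = reindex (by omega) (w (N - 1)) ∧
        ∀ j : ℕ, j + 2 ≤ N + N → j ≠ N - 1 → pihat q (N + N) j (w N) = 0) →
      ∀ N : ℕ, w N = vrainbow q N) := by
  refine ⟨?_, fun N => ⟨v_K hq N, v_E hq N⟩, ?_, ?_⟩
  · ext m
    have : wt (fun _ => 1) m = 0 := by simp [wt]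
    have h2 : wt (fun i => i) m = 0 := by simp [wt]
    have h3 : lw 0 m = 0 := by simp [lw, wt]
    rw [v_closed hq, if_pos this, h2, h3]
    simp [vv, Cc, qfact, tri, qint_one hq]
  · intro N hN
    refine ⟨?_, fun j h1 h2 => v_side hq N j h1 h2⟩
    obtain ⟨N, rfl⟩ : ∃ M, N = M + 1 := ⟨N - 1, by omega⟩
    exact v_mid hq N _
  · intro w w0 wKE wp N
    induction N with
    | zero =>
      rw [w0]
      ext m
      have : wt (fun _ => 1) m = 0 := by simp [wt]
      have h2 : wt (fun i => i) m = 0 := by simp [wt]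
      have h3 : lw 0 m = 0 := by simp [lw, wt]
      rw [v_closed hq, if_pos this, h2, h3]
      simp [vv, Cc, qfact, tri, qint_one hq]
    | succ N ih =>
      rw [← sub_eq_zero]
      apply unique hq (N+1) (by omega)
      · have h1 := (wKE (N+1)).1
        have h2 := v_K hq (N+1)
        ext m
        have h1 := congrFun h1 m
        have h2 := congrFun h2 m
        simp only [Kop, Pi.sub_apply] at *
        rw [mul_sub, h1, h2]
      · have h1 := (wKE (N+1)).2
        have h2 := v_E hq (N+1)
        ext m
        have h1 := congrFun h1 m
        have h2 := congrFun h2 m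
        simp only [Eop, Pi.sub_apply, Pi.zero_apply] at *
        refine Eq.trans ?_ ((congrArg₂ (· - ·) h1 h2).trans (sub_zero 0))
        rw [← Finset.sum_sub_distrib]
        apply Finset.sum_congr rfl
        intro i _
        split_ifs <;> ring
      · intro j hj
        have : pihat q (N+1+(N+1)) j (w (N+1) - vrainbow q (N+1)) =
          pihat q (N+1+(N+1)) j (w (N+1)) - pihat q (N+1+(N+1)) j (vrainbow q (N+1)) := by
          ext m
          simp only [pihat_apply, Pi.sub_apply]; ring
        rw [this, sub_eq_zero]
        by_cases h : j = N
        · subst h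
          have h1 := (wp (j+1) (by omega)).1
          have h2 := v_mid hq j (by omega)
          refine Eq.trans h1 (Eq.trans ?_ h2.symm)
          exact congrArg (reindex _) ih
        · rw [v_side hq (N+1) j hj h, (wp (N+1) (by omega)).2 j hj h]
end
end
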